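/- arXiv:2102.08022 — 9 statements merged into one kernel-verified Lean document; each statement's English description precedes it below -/
import Mathlib

section
/- Let G(x,y,z,w) = x^3*y + y^3*z + z^3*w + w^3*x + x*y*z*w. For every algebraically closed field K of characteristic zero and every (a,b,c,d) ∈ K^4, if all four partial derivatives of G vanish at (a,b,c,d), i.e. 3a^2*b + d^3 + b*c*d = 0, a^3 + 3b^2*c + a*c*d = 0, b^3 + 3c^2*d + a*b*d = 0, and c^3 + 3d^2*a + a*b*c = 0, then a = b = c = d = 0. (Equivalently, the quartic surface X ⊆ P^3 defined by G = 0 is smooth over ℚ, hence a K3 surface.) -/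
/-- If one coordinate of a common zero of the partial derivatives vanishes, all of them do. -/
theorem eq_zero_of_partials_of_eq_zero {K : Type*} [Field K] {a b c d : K}
    (h1 : 3 * a ^ 2 * b + d ^ 3 + b * c * d = 0)
    (h3 : b ^ 3 + 3 * c ^ 2 * d + a * b * d = 0)
    (h4 : c ^ 3 + 3 * d ^ 2 * a + a * b * c = 0) (ha : a = 0) :
    a = 0 ∧ b = 0 ∧ c = 0 ∧ d = 0 := by
  subst ha
  have hc : c = 0 := by simpa using h4
  subst hc
  have hb : b = 0 := by simpa using h3
  subst hb
  have hd : d = 0 := by simpa using h1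
  exact ⟨rfl, rfl, rfl, hd⟩

/-- Let `G(x,y,z,w) = x^3*y + y^3*z + z^3*w + w^3*x + x*y*z*w`. For every
algebraically closed field `K` of characteristic zero and every `(a,b,c,d) ∈ K^4`, if all
four partial derivatives of `G` vanish at `(a,b,c,d)`, then `a = b = c = d = 0`. -/
theorem smooth_char_zero (K : Type*) [Field K] [IsAlgClosed K] [CharZero K]
    (a b c d : K)
    (h1 : 3 * a ^ 2 * b + d ^ 3 + b * c * d = 0)
    (h2 : a ^ 3 + 3 * b ^ 2 * c + a * c * d = 0)
    (h3 : b ^ 3 + 3 * c ^ 2 * d + a * b * d = 0)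
    (h4 : c ^ 3 + 3 * d ^ 2 * a + a * b * c = 0) :
    a = 0 ∧ b = 0 ∧ c = 0 ∧ d = 0 := by
  -- The Euler-type products `a * h1`, …, `d * h4` form an invertible linear system.
  have hA : 4 * (a ^ 3 * b) = -(a * b * c * d) := by
    linear_combination (27 * a * h1 - b * h2 + 3 * c * h3 - 9 * d * h4) / 20
  have hB : 4 * (b ^ 3 * c) = -(a * b * c * d) := by
    linear_combination (27 * b * h2 - c * h3 + 3 * d * h4 - 9 * a * h1) / 20
  have hC : 4 * (c ^ 3 * d) = -(a * b * c * d) := by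
    linear_combination (27 * c * h3 - d * h4 + 3 * a * h1 - 9 * b * h2) / 20
  have hD : 4 * (d ^ 3 * a) = -(a * b * c * d) := by
    linear_combination (27 * d * h4 - a * h1 + 3 * b * h2 - 9 * c * h3) / 20
  have he : 255 * (a * b * c * d) ^ 4 = 0 := by
    calc 255 * (a * b * c * d) ^ 4
        = 4 * (a ^ 3 * b) * (4 * (b ^ 3 * c)) * (4 * (c ^ 3 * d)) * (4 * (d ^ 3 * a))
          - (a * b * c * d) ^ 4 := by ring
      _ = 0 := by rw [hA, hB, hC, hD]; ring
  have hprod : ((a = 0 ∨ b = 0) ∨ c = 0) ∨ d = 0 := by simpa using he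
  rcases hprod with ((h | h) | h) | h
  · exact eq_zero_of_partials_of_eq_zero h1 h3 h4 h
  · have := eq_zero_of_partials_of_eq_zero (a := b) (b := c) (c := d) (d := a)
      (by linear_combination h2) (by linear_combination h4) (by linear_combination h1) h
    tauto
  · have := eq_zero_of_partials_of_eq_zero (a := c) (b := d) (c := a) (d := b)
      (by linear_combination h3) (by linear_combination h1) (by linear_combination h2) h
    tauto
  · have := eq_zero_of_partials_of_eq_zero (a := d) (b := a) (c := b) (d := c)
      (by linear_combination h4) (by linear_combination h2) (by linear_combination h3) h
    tauto
end

section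
/- Let G(x,y,z,w) = x^3*y + y^3*z + z^3*w + w^3*x + x*y*z*w. For every prime number p with p ∉ {3, 5, 17}, and every algebraically closed field K of characteristic p, if (a,b,c,d) ∈ K^4 satisfies G(a,b,c,d) = 0 and all four partial derivatives of G vanish at (a,b,c,d) (i.e. 3a^2*b + d^3 + b*c*d = 0, a^3 + 3b^2*c + a*c*d = 0, b^3 + 3c^2*d + a*b*d = 0, c^3 + 3d^2*a + a*b*c = 0), then a = b = c = d = 0. (Equivalently, the projective ℤ-scheme 𝒳 defined by G = 0 has good reduction at every prime p ∉ {3, 5, 17}; in particular it has good reduction at 2.) -/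
/-- Let `G(x,y,z,w) = x^3*y + y^3*z + z^3*w + w^3*x + x*y*z*w`. For every prime
`p ∉ {3, 5, 17}` and every algebraically closed field `K` of characteristic `p`, if
`(a,b,c,d) ∈ K^4` satisfies `G(a,b,c,d) = 0` and all four partial derivatives of `G` vanish
at `(a,b,c,d)`, then `a = b = c = d = 0`. -/
theorem good_reduction_away_from_3_5_17 (p : ℕ) (hp : p.Prime)
    (hp3 : p ≠ 3) (hp5 : p ≠ 5) (hp17 : p ≠ 17)
    (K : Type*) [Field K] [IsAlgClosed K] [CharP K p]
    (a b c d : K)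
    (hG : a ^ 3 * b + b ^ 3 * c + c ^ 3 * d + d ^ 3 * a + a * b * c * d = 0)
    (h1 : 3 * a ^ 2 * b + d ^ 3 + b * c * d = 0)
    (h2 : a ^ 3 + 3 * b ^ 2 * c + a * c * d = 0)
    (h3 : b ^ 3 + 3 * c ^ 2 * d + a * b * d = 0)
    (h4 : c ^ 3 + 3 * d ^ 2 * a + a * b * c = 0) :
    a = 0 ∧ b = 0 ∧ c = 0 ∧ d = 0 := by
  have h_ne (q : ℕ) (hq : q.Prime) (hpq : p ≠ q) : (q : K) ≠ 0 := fun h =>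
    hpq ((Nat.prime_dvd_prime_iff_eq hp hq).1 ((CharP.cast_eq_zero_iff K p q).1 h))
  have hK3 : (3 : K) ≠ 0 := by exact_mod_cast h_ne 3 (by norm_num) hp3
  have hK5 : (5 : K) ≠ 0 := by exact_mod_cast h_ne 5 (by norm_num) hp5
  have hK17 : (17 : K) ≠ 0 := by exact_mod_cast h_ne 17 (by norm_num) hp17
  -- The equations `x ∂G/∂x = 0` and `G = 0` are linear in the five monomials of `G`.
  have he : a * b * c * d = -4 * (a ^ 3 * b) := by
    apply mul_left_cancel₀ hK5
    linear_combination -hG + 7 * a * h1 + c * h3 - 2 * d * h4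
  have hD : d ^ 3 * a = a ^ 3 * b := by linear_combination a * h1 - he
  have hC : c ^ 3 * d = a ^ 3 * b := by linear_combination d * h4 - he - 3 * hD
  have hB : b ^ 3 * c = a ^ 3 * b := by linear_combination c * h3 - he - 3 * hC
  have hA : a ^ 3 * b = 0 := by
    have hprod : 3 * 5 * 17 * (a ^ 3 * b) ^ 4 = 0 := by
      have hmul : (a * b * c * d) ^ 4 =
          (a ^ 3 * b) * (b ^ 3 * c) * (c ^ 3 * d) * (d ^ 3 * a) := by ring
      rw [hB, hC, hD, he] at hmul
      linear_combination hmul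
    simpa [hK3, hK5, hK17] using hprod
  rw [hA] at hB hC hD
  have ha : a = 0 := by
    by_contra ha
    have hb : b = 0 := by simpa [ha] using hA
    have hd : d = 0 := by simpa [ha] using hD
    exact ha (by simpa [hb, hd] using h2)
  have hc : c = 0 := by simpa [ha] using h4
  exact ⟨ha, by simpa [ha, hc] using h3, hc, by simpa [ha, hc] using h1⟩
end

section
/- Let G(x,y,z,w) = x^3*y + y^3*z + z^3*w + w^3*x + x*y*z*w, and let p ∈ {3, 5, 17}. For every (a,b,c,d) ∈ (ℤ/p^2ℤ)^4 such that G(a,b,c,d) = 0 and at least one of a, b, c, d is a unit in ℤ/p^2ℤ, the reduction (ā, b̄, c̄, d̄) ∈ (𝔽_p)^4 modulo p is a smooth point of the reduction Y_p: not all four partial derivatives of G vanish at (ā, b̄, c̄, d̄). (That is, the unique singular point of Y_p does not lift to a ℤ/p^2ℤ-point of 𝒳; hence every ℤ_p-point of 𝒳 reduces to the smooth locus of Y_p.) -/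
/-- A common zero of the first, third and fourth partial derivatives of `G` with a nonzero
coordinate has nonzero first coordinate. -/
theorem ne_zero_of_partials_eq_zero {K : Type*} [Field K] {x y z w : K}
    (hx : 3 * x ^ 2 * y + w ^ 3 + y * z * w = 0)
    (hz : y ^ 3 + 3 * z ^ 2 * w + x * y * w = 0)
    (hw : z ^ 3 + 3 * w ^ 2 * x + x * y * z = 0)
    (h : x ≠ 0 ∨ y ≠ 0 ∨ z ≠ 0 ∨ w ≠ 0) : x ≠ 0 := by
  rintro rfl
  have hz0 : z = 0 := by simpa using hw
  subst hz0
  have hy0 : y = 0 := by simpa using hz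
  subst hy0
  have hw0 : w = 0 := by simpa using hx
  simp [hw0] at h

/-- Modulo `3`, `5` and `17`, the only common zero of the dehomogenised partial derivatives
of `G` is `(1, -4, 16, -64)`. -/
theorem affine_singular_point_eq {p : ℕ} (hp : p = 3 ∨ p = 5 ∨ p = 17) :
    ∀ y z w : ZMod p, 3 * y + w ^ 3 + y * z * w = 0 ∧ 1 + 3 * y ^ 2 * z + z * w = 0 ∧
      y ^ 3 + 3 * z ^ 2 * w + y * w = 0 ∧ z ^ 3 + 3 * w ^ 2 + y * z = 0 →
      y = -4 ∧ z = 16 ∧ w = -64 := by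
  rcases hp with rfl | rfl | rfl <;> decide +kernel

/-- Modulo `3`, `5` and `17`, the singular points of `G = 0` with nonzero first coordinate are
the multiples of `(1, -4, 16, -64)`. -/
theorem singular_point_eq {p : ℕ} [Fact p.Prime] (hp : p = 3 ∨ p = 5 ∨ p = 17)
    {x y z w : ZMod p} (h0 : x ≠ 0)
    (hx : 3 * x ^ 2 * y + w ^ 3 + y * z * w = 0)
    (hy : x ^ 3 + 3 * y ^ 2 * z + x * z * w = 0)
    (hz : y ^ 3 + 3 * z ^ 2 * w + x * y * w = 0)
    (hw : z ^ 3 + 3 * w ^ 2 * x + x * y * z = 0) :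
    y = -4 * x ∧ z = 16 * x ∧ w = -64 * x := by
  have key := affine_singular_point_eq hp (y / x) (z / x) (w / x)
    ⟨by field_simp; linear_combination hx, by field_simp; linear_combination hy,
      by field_simp; linear_combination hz, by field_simp; linear_combination hw⟩
  simpa only [div_eq_iff h0] using key

/-- An integral zero of `G` modulo `p ^ 2` reducing modulo `p` to a multiple of
`(1, -4, 16, -64)` reduces to zero. -/
theorem dvd_of_sq_dvd_quartic {p : ℕ} (hp : p = 3 ∨ p = 5 ∨ p = 17) {a s t u b c d : ℤ}
    (hb : b = -4 * a + p * s) (hc : c = 16 * a + p * t) (hd : d = -64 * a + p * u)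
    (h : (p : ℤ) ^ 2 ∣ a ^ 3 * b + b ^ 3 * c + c ^ 3 * d + d ^ 3 * a + a * b * c * d) :
    (p : ℤ) ∣ a := by
  have hprime : Prime (p : ℤ) := by
    rw [← Nat.prime_iff_prime_int]
    rcases hp with rfl | rfl | rfl <;> norm_num
  obtain ⟨m, hm⟩ : (p : ℤ) ∣ 255 := by
    rcases hp with rfl | rfl | rfl <;> norm_num
  have hnd : ¬ (p : ℤ) ∣ 2044 * m := by
    rcases hp with rfl | rfl | rfl <;> push_cast at hm ⊢ <;> omega
  obtain ⟨k, hk⟩ := h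
  have hdvd : (p : ℤ) ∣ 2044 * m * a ^ 4 := by
    refine ⟨m * a ^ 3 * (64 * u - 192 * t - s) +
      (48 * a ^ 2 * s * t + (p * s ^ 3 - 12 * a * s ^ 2) * c +
        768 * a ^ 2 * t * u + (48 * a * t ^ 2 + p * t ^ 3) * d +
        (p * u ^ 3 - 192 * a * u ^ 2) * a +
        a * (16 * a * s * u - 4 * a * t * u - 64 * a * s * t + p * s * t * u)) - k, ?_⟩
    apply mul_left_cancel₀ hprime.ne_zero
    subst hb hc hd
    linear_combination (-2044 * a ^ 4 + p * a ^ 3 * (64 * u - 192 * t - s)) * hm - hk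
  exact hprime.dvd_of_dvd_pow ((hprime.dvd_or_dvd hdvd).resolve_left hnd)

/-- for `p ∈ {3, 5, 17}`, every solution `(a,b,c,d)` of `G = 0` over
`ℤ/p²ℤ` with at least one unit coordinate reduces modulo `p` to a smooth point of the
reduction: not all four partial derivatives of `G` vanish at the reduction. Here
`G(x,y,z,w) = x^3*y + y^3*z + z^3*w + w^3*x + x*y*z*w`. -/
theorem singular_point_does_not_lift (p : ℕ) (hp : p = 3 ∨ p = 5 ∨ p = 17)
    (a b c d : ZMod (p ^ 2))
    (hG : a ^ 3 * b + b ^ 3 * c + c ^ 3 * d + d ^ 3 * a + a * b * c * d = 0)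
    (hu : IsUnit a ∨ IsUnit b ∨ IsUnit c ∨ IsUnit d) :
    ¬ (let φ := ZMod.castHom (dvd_pow_self p two_ne_zero) (ZMod p);
       3 * φ a ^ 2 * φ b + φ d ^ 3 + φ b * φ c * φ d = 0 ∧
       φ a ^ 3 + 3 * φ b ^ 2 * φ c + φ a * φ c * φ d = 0 ∧
       φ b ^ 3 + 3 * φ c ^ 2 * φ d + φ a * φ b * φ d = 0 ∧
       φ c ^ 3 + 3 * φ d ^ 2 * φ a + φ a * φ b * φ c = 0) := by
  have : Fact p.Prime := ⟨by rcases hp with rfl | rfl | rfl <;> norm_num⟩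
  rintro ⟨hx, hy, hz, hw⟩
  set φ := ZMod.castHom (dvd_pow_self p two_ne_zero) (ZMod p)
  have hne : φ a ≠ 0 := ne_zero_of_partials_eq_zero hx hz hw <| by
    rcases hu with h | h | h | h
    · exact .inl (h.map φ).ne_zero
    · exact .inr (.inl (h.map φ).ne_zero)
    · exact .inr (.inr (.inl (h.map φ).ne_zero))
    · exact .inr (.inr (.inr (h.map φ).ne_zero))
  obtain ⟨hb, hc, hd⟩ := singular_point_eq hp hne hx hy hz hw
  obtain ⟨a, rfl⟩ := ZMod.intCast_surjective a
  obtain ⟨b, rfl⟩ := ZMod.intCast_surjective b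
  obtain ⟨c, rfl⟩ := ZMod.intCast_surjective c
  obtain ⟨d, rfl⟩ := ZMod.intCast_surjective d
  have lift {e n : ℤ} (h : (e : ZMod p) = n * a) : ∃ s, e = n * a + p * s := by
    rw [← Int.cast_mul, eq_comm, ZMod.intCast_eq_intCast_iff_dvd_sub] at h
    obtain ⟨s, hs⟩ := h
    exact ⟨s, by linear_combination hs⟩
  simp only [map_intCast] at hne hb hc hd
  obtain ⟨s, hs⟩ := lift (n := -4) (by exact_mod_cast hb)
  obtain ⟨t, ht⟩ := lift (n := 16) (by exact_mod_cast hc)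
  obtain ⟨u, hu⟩ := lift (n := -64) (by exact_mod_cast hd)
  refine hne ((ZMod.intCast_zmod_eq_zero_iff_dvd a p).2 (dvd_of_sq_dvd_quartic hp hs ht hu ?_))
  have := (ZMod.intCast_zmod_eq_zero_iff_dvd
    (a ^ 3 * b + b ^ 3 * c + c ^ 3 * d + d ^ 3 * a + a * b * c * d) (p ^ 2)).1
    (by exact_mod_cast hG)
  exact_mod_cast this
end

section
/- Let p ∈ {3, 5, 17}. The polynomial G = x^3*y + y^3*z + z^3*w + w^3*x + x*y*z*w is irreducible in the polynomial ring 𝔽_p[x,y,z,w] (i.e. as an element of MvPolynomial (Fin 4) (ZMod p)). (That is, the reduction Y_p of the ℤ-model 𝒳 modulo p is an irreducible 𝔽_p-scheme.) -/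
open MvPolynomial

/-- A factor of degree at most one of the cubic `y T³ + (w³ + yzw) T + (y³z + z³w)` is a unit, if
`y` is a prime not dividing `w` and `w²` does not divide `z³` modulo `y`. -/
lemma isUnit_of_mul_eq_cubic {R : Type*} [CommRing R] [IsDomain R] {y z w : R} (hy : Prime y)
    (hw : ¬ y ∣ w) (hzw : ∀ b, ¬ y ∣ b * w ^ 2 - z ^ 3) {A B : Polynomial R}
    (hAB : A * B = .C y * .X ^ 3 + .C (w ^ 3 + y * z * w) * .X + .C (y ^ 3 * z + z ^ 3 * w))
    (hA : A.natDegree ≤ 1) : IsUnit A := by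
  have hz : ¬ y ∣ z ^ 3 * w := fun h => by
    rcases hy.dvd_or_dvd h with h | h
    · exact hzw 0 (by simpa using h)
    · exact hw h
  have hdeg : (A * B).natDegree = 3 := by
    rw [hAB]
    compute_degree!
    exact hy.ne_zero
  have hne : A * B ≠ 0 := by
    intro h
    simp [h] at hdeg
  rw [Polynomial.natDegree_mul (left_ne_zero_of_mul hne) (right_ne_zero_of_mul hne)] at hdeg
  obtain ⟨a, b, rfl⟩ := Polynomial.exists_eq_X_add_C_of_natDegree_le_one hA
  have coeff_eq (n : ℕ) := congrArg (Polynomial.coeff · n) hAB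
  have h0 := coeff_eq 0
  have h1 := coeff_eq 1
  have h2 := coeff_eq 2
  have h3 := coeff_eq 3
  simp only [add_mul, mul_assoc, Polynomial.coeff_add, Polynomial.coeff_C_mul,
    Polynomial.coeff_X_mul, Polynomial.coeff_X_mul_zero, Polynomial.coeff_X_pow,
    Polynomial.coeff_X, Polynomial.coeff_C] at h0 h1 h2 h3
  norm_num at h0 h1 h2 h3
  by_cases ha : a = 0
  · subst ha
    simp only [zero_mul, zero_add] at h0 h1 h2 h3 ⊢
    rw [map_zero, zero_mul, zero_add]
    refine (hy.irreducible.isUnit_or_isUnit h3.symm).elim (fun h => h.map Polynomial.C) fun h => ?_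
    exfalso
    have hb : y ∣ b := (h.dvd_mul_right).1 ⟨1, by rw [h3, mul_one]⟩
    exact hz ((dvd_add_right ⟨y ^ 2 * z, by ring⟩).1 (h0 ▸ hb.mul_right _))
  · have hB : B.natDegree = 2 := by
      rw [Polynomial.natDegree_linear ha] at hdeg
      omega
    have hB3 : B.coeff 3 = 0 := Polynomial.coeff_eq_zero_of_natDegree_lt (by omega)
    rw [hB3, mul_zero, add_zero] at h3
    exfalso
    rcases hy.irreducible.isUnit_or_isUnit h3.symm with h | h
    · obtain ⟨u, hu⟩ := h.exists_right_inv
      refine (hy.dvd_or_dvd (a := w) (b := u * b * w ^ 2 - z ^ 3) ?_).elim hw (hzw _)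
      refine ⟨y ^ 2 * z - u * b * z * w - u * b * b * b * u * u, ?_⟩
      linear_combination -u * b * h1 + h0 + u ^ 2 * b ^ 2 * h2 - u ^ 3 * b ^ 3 * h3 +
        (b * B.coeff 0 - u * b ^ 2 * B.coeff 1 + u ^ 2 * b ^ 3 * B.coeff 2) * hu
    · have ha' : y ∣ a := h.dvd_mul_right.1 ⟨1, by rw [h3, mul_one]⟩
      have hb : y ∣ b := by
        refine h.dvd_mul_right.1 ((dvd_add_right (ha'.mul_right (B.coeff 1))).1 ?_)
        rw [h2]
        exact dvd_zero y
      exact hz ((dvd_add_right ⟨y ^ 2 * z, by ring⟩).1 (h0 ▸ hb.mul_right _))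

/-- The cubic `y T³ + (w³ + yzw) T + (y³z + z³w)` is irreducible if `y` is a prime not dividing `w`
and `w²` does not divide `z³` modulo `y`. -/
lemma irreducible_cubic {R : Type*} [CommRing R] [IsDomain R] {y z w : R} (hy : Prime y)
    (hw : ¬ y ∣ w) (hzw : ∀ b, ¬ y ∣ b * w ^ 2 - z ^ 3) :
    Irreducible (.C y * .X ^ 3 + .C (w ^ 3 + y * z * w) * .X + .C (y ^ 3 * z + z ^ 3 * w) :
      Polynomial R) := by
  have hdeg : (.C y * .X ^ 3 + .C (w ^ 3 + y * z * w) * .X + .C (y ^ 3 * z + z ^ 3 * w) :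
      Polynomial R).natDegree = 3 := by
    compute_degree!
    exact hy.ne_zero
  refine ⟨fun h => ?_, fun A B hAB => ?_⟩
  · rw [Polynomial.natDegree_eq_zero_of_isUnit h] at hdeg
    omega
  · have hne : A * B ≠ 0 := by
      intro h
      rw [hAB, h] at hdeg
      simp at hdeg
    rw [hAB, Polynomial.natDegree_mul (left_ne_zero_of_mul hne) (right_ne_zero_of_mul hne)] at hdeg
    rcases le_or_gt A.natDegree 1 with hA | hA
    · exact .inl (isUnit_of_mul_eq_cubic hy hw hzw hAB.symm hA)
    · exact .inr (isUnit_of_mul_eq_cubic hy hw hzw ((mul_comm B A).trans hAB.symm) (by omega))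

/-- The quartic `x³y + y³z + z³w + w³x + xyzw` is irreducible over any field. -/
theorem irreducible_quartic (k : Type*) [Field k] :
    Irreducible
      (X 0 ^ 3 * X 1 + X 1 ^ 3 * X 2 + X 2 ^ 3 * X 3 + X 3 ^ 3 * X 0 +
        X 0 * X 1 * X 2 * X 3 : MvPolynomial (Fin 4) k) := by
  rw [← MulEquiv.irreducible_iff (finSuccEquiv k 3)]
  have key : Irreducible (.C (X 0) * .X ^ 3 + .C (X 2 ^ 3 + X 0 * X 1 * X 2) * .X +
      .C (X 0 ^ 3 * X 1 + X 1 ^ 3 * X 2) : Polynomial (MvPolynomial (Fin 3) k)) := by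
    refine irreducible_cubic (X_prime (i := 0)) (fun h => ?_) fun b h => ?_
    · simpa using map_dvd (aeval ![0, 0, 1] : MvPolynomial (Fin 3) k →ₐ[k] k) h
    · simpa using map_dvd (aeval ![0, 1, 0] : MvPolynomial (Fin 3) k →ₐ[k] k) h
  convert key using 1
  have e1 : (1 : Fin 4) = Fin.succ 0 := rfl
  have e2 : (2 : Fin 4) = Fin.succ 1 := rfl
  have e3 : (3 : Fin 4) = Fin.succ 2 := rfl
  simp only [e1, e2, e3, map_add, map_mul, map_pow, finSuccEquiv_X_zero, finSuccEquiv_X_succ]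
  ring

/-- for `p ∈ {3, 5, 17}`, the polynomial
`G = x^3*y + y^3*z + z^3*w + w^3*x + x*y*z*w` is irreducible in `𝔽_p[x,y,z,w]`. -/
theorem reduction_irreducible (p : ℕ) [Fact p.Prime] (hp : p = 3 ∨ p = 5 ∨ p = 17) :
    Irreducible
      (X 0 ^ 3 * X 1 + X 1 ^ 3 * X 2 + X 2 ^ 3 * X 3 + X 3 ^ 3 * X 0 +
        X 0 * X 1 * X 2 * X 3 : MvPolynomial (Fin 4) (ZMod p)) :=
  irreducible_quartic (ZMod p)
end

section
/- There exists d ∈ ℤ_2 (the ring of 2-adic integers) such that d^3 + 3*d + 10 = 0, d ≡ 2 (mod 8), and d^2 + 3 ≡ 7 (mod 8). (Equivalently: the point P_2 = (1 : 2 : 1 : d) lies on X(ℚ_2), its reduction modulo 8 is (1 : 2 : 1 : 2), and the value f(P_2) = f(1,2,1,d) = d^2 + 3 of f = z^3 + w^2*x + x*y*z at P_2 is congruent to 7 modulo 8.) -/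
/-- there exists `d ∈ ℤ_2` with `d^3 + 3·d + 10 = 0`, `d ≡ 2 (mod 8)` and
`d^2 + 3 ≡ 7 (mod 8)`. -/
theorem exists_two_adic_point :
    ∃ d : ℤ_[2], d ^ 3 + 3 * d + 10 = 0 ∧ (8 : ℤ_[2]) ∣ (d - 2) ∧
      (8 : ℤ_[2]) ∣ (d ^ 2 + 3 - 7) := by
  let F : Polynomial ℤ_[2] := Polynomial.X ^ 3 + 3 * Polynomial.X + 10
  have hF (x : ℤ_[2]) : F.aeval x = x ^ 3 + 3 * x + 10 := by
    simp [F]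
  have hF' : F.derivative.aeval (2 : ℤ_[2]) = 15 := by
    simp [F]
    norm_num
  have norm_fifteen : ‖(15 : ℤ_[2])‖ = 1 := by
    refine le_antisymm (PadicInt.norm_le_one _) (not_lt.mp fun h => ?_)
    have := (PadicInt.norm_int_lt_one_iff_dvd (p := 2) 15).mp (mod_cast h)
    norm_num at this
  have norm_twentyfour : ‖(24 : ℤ_[2])‖ < 1 :=
    mod_cast (PadicInt.norm_int_lt_one_iff_dvd (p := 2) 24).mpr (by norm_num)
  obtain ⟨d, hd, hd2, -⟩ := hensels_lemma (F := F) (a := (2 : ℤ_[2])) (by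
    rw [hF, hF', norm_fifteen]
    norm_num [norm_twentyfour])
  rw [hF] at hd
  rw [hF', norm_fifteen, PadicInt.norm_lt_one_iff_dvd] at hd2
  obtain ⟨k, hk⟩ := hd2
  push_cast at hk
  -- With `u = 7 + 6 * k + 2 * k ^ 2` we have `(d - 2) * (1 + 2 * u) = -24`; invert `1 + 2 * u` modulo 16.
  have h8 : (8 : ℤ_[2]) ∣ d - 2 := by
    obtain ⟨u, hu⟩ : ∃ u, u = 7 + 6 * k + 2 * k ^ 2 := ⟨_, rfl⟩
    have h : (d - 2) * (1 + 2 * u) = -24 := by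
      obtain rfl : d = 2 + 2 * k := by linear_combination hk
      subst hu
      linear_combination hd
    exact ⟨-3 * (1 - 2 * u) * (1 + 4 * u ^ 2) + 2 * u ^ 4 * (d - 2), by
      linear_combination (1 - 2 * u) * (1 + 4 * u ^ 2) * h⟩
  refine ⟨d, hd, h8, ?_⟩
  rw [show d ^ 2 + 3 - 7 = (d - 2) * (d + 2) by ring]
  exact h8.mul_right _
end

section
/- Let G(a,b,c,d) = a^3*b + b^3*c + c^3*d + d^3*a + a*b*c*d and f(a,b,c,d) = c^3 + d^2*a + a*b*c. For all real numbers a, b, c, d with G(a,b,c,d) = 0, a ≠ 0, c ≠ 0 and f(a,b,c,d) ≠ 0, one has 0 < −c/a or 0 < f(a,b,c,d)/a^3. (This says that at every real point P of X with x(P), z(P), f(P) ≠ 0 the quaternion algebra 𝒜 = (f/x^3, −z/x) evaluates trivially in Br(ℝ), so the evaluation map |𝒜| : X(ℝ) → Br(ℝ) is constant equal to 0.) -/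
theorem four_mul_le_cyclic_quartic {x y z w : ℝ}
    (hx : 0 ≤ x) (hy : 0 ≤ y) (hz : 0 ≤ z) (hw : 0 ≤ w) :
    4 * (x * y * z * w) ≤ x ^ 3 * y + y ^ 3 * z + z ^ 3 * w + w ^ 3 * x := by
  set p := x ^ 3 * y + z ^ 3 * w with hp
  set q := y ^ 3 * z + w ^ 3 * x with hq
  have hp0 : 0 ≤ p := by positivity
  have hq0 : 0 ≤ q := by positivity
  have hp2 : 4 * (x ^ 3 * y * (z ^ 3 * w)) ≤ p ^ 2 := by
    nlinarith [sq_nonneg (x ^ 3 * y - z ^ 3 * w)]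
  have hq2 : 4 * (y ^ 3 * z * (w ^ 3 * x)) ≤ q ^ 2 := by
    nlinarith [sq_nonneg (y ^ 3 * z - w ^ 3 * x)]
  have hpq : 4 * (x * y * z * w) ^ 2 ≤ p * q := by
    refine le_of_sq_le_sq ?_ (by positivity)
    calc (4 * (x * y * z * w) ^ 2) ^ 2
        = 4 * (x ^ 3 * y * (z ^ 3 * w)) * (4 * (y ^ 3 * z * (w ^ 3 * x))) := by ring
      _ ≤ p ^ 2 * q ^ 2 := mul_le_mul hp2 hq2 (by positivity) (by positivity)
      _ = (p * q) ^ 2 := by ring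
  have h : 4 * (x * y * z * w) ≤ p + q :=
    le_of_sq_le_sq (by nlinarith [sq_nonneg (p - q)]) (by positivity)
  linarith

theorem cubic_nonneg_of_quartic_eq_zero {a b c d : ℝ}
    (hG : a ^ 3 * b + b ^ 3 * c + c ^ 3 * d + d ^ 3 * a + a * b * c * d = 0)
    (ha : 0 < a) (hc : 0 < c) : 0 ≤ c ^ 3 + d ^ 2 * a + a * b * c := by
  by_contra! hf
  have hb : b < 0 := by
    by_contra! hb
    have : 0 ≤ c ^ 3 + d ^ 2 * a + a * b * c := by positivity
    linarith
  have hs : b * (a ^ 3 + b ^ 2 * c) < 0 := mul_neg_of_neg_of_pos hb (by positivity)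
  have hd : d < 0 := by
    by_contra! hd
    have := mul_nonpos_of_nonneg_of_nonpos hd hf.le
    linarith
  have h := four_mul_le_cyclic_quartic ha.le (neg_nonneg.2 hb.le) hc.le (neg_nonneg.2 hd.le)
  have hpos : 0 < a * b * c * d := by
    have := mul_pos (mul_pos ha hc) (mul_pos_of_neg_of_neg hb hd)
    linarith
  linarith

/-- at every real point of `G = 0` with `a ≠ 0`, `c ≠ 0` and
`f(a,b,c,d) = c^3 + d^2*a + a*b*c ≠ 0`, one has `0 < -c/a` or `0 < f/a^3`.
Here `G(a,b,c,d) = a^3*b + b^3*c + c^3*d + d^3*a + a*b*c*d`. -/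
theorem real_evaluation_trivial (a b c d : ℝ)
    (hG : a ^ 3 * b + b ^ 3 * c + c ^ 3 * d + d ^ 3 * a + a * b * c * d = 0)
    (ha : a ≠ 0) (hc : c ≠ 0) (hf : c ^ 3 + d ^ 2 * a + a * b * c ≠ 0) :
    0 < -c / a ∨ 0 < (c ^ 3 + d ^ 2 * a + a * b * c) / a ^ 3 := by
  rcases lt_or_gt_of_ne ha with ha | ha <;> rcases lt_or_gt_of_ne hc with hc | hc
  · right
    have h := cubic_nonneg_of_quartic_eq_zero (a := -a) (b := -b) (c := -c) (d := -d)
      (by linarith) (neg_pos.2 ha) (neg_pos.2 hc)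
    exact div_pos_of_neg_of_neg (lt_of_le_of_ne (by linarith) hf) (Odd.pow_neg (by decide) ha)
  · exact .inl (div_pos_of_neg_of_neg (neg_neg_of_pos hc) ha)
  · exact .inl (div_pos (neg_pos.2 hc) ha)
  · right
    exact div_pos (lt_of_le_of_ne (cubic_nonneg_of_quartic_eq_zero hG ha hc) hf.symm)
      (by positivity)
end

section
/- Let G(a,b,c,d) = a^3*b + b^3*c + c^3*d + d^3*a + a*b*c*d. There are no real numbers a, b, c, d with G(a,b,c,d) = 0, a > 0, c > 0, and b, d of the same (strict) sign: it is impossible that b > 0 and d > 0, and it is impossible that b < 0 and d < 0. -/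
/-- there are no real numbers `a, b, c, d` with
`G(a,b,c,d) = a^3*b + b^3*c + c^3*d + d^3*a + a*b*c*d = 0`, `a > 0`, `c > 0`, and
`b, d` of the same strict sign. -/
theorem no_real_point_same_sign (a b c d : ℝ)
    (hG : a ^ 3 * b + b ^ 3 * c + c ^ 3 * d + d ^ 3 * a + a * b * c * d = 0)
    (ha : 0 < a) (hc : 0 < c) :
    ¬ (0 < b ∧ 0 < d) ∧ ¬ (b < 0 ∧ d < 0) := by
  constructor
  · rintro ⟨hb, hd⟩
    have : 0 < a ^ 3 * b + b ^ 3 * c + c ^ 3 * d + d ^ 3 * a + a * b * c * d := by positivity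
    exact this.ne' hG
  · rintro ⟨hb, hd⟩
    obtain ⟨p, rfl⟩ : ∃ p, b = -p := ⟨-b, by ring⟩
    obtain ⟨q, rfl⟩ : ∃ q, d = -q := ⟨-d, by ring⟩
    have hp : 0 < p := by linarith
    have hq : 0 < q := by linarith
    have hx : 0 < a ^ 3 * p := by positivity
    have hy : 0 < p ^ 3 * c := by positivity
    have hz : 0 < c ^ 3 * q := by positivity
    have hw : 0 < q ^ 3 * a := by positivity
    have hm : a * p * c * q = a ^ 3 * p + p ^ 3 * c + c ^ 3 * q + q ^ 3 * a := by
      linear_combination hG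
    -- The four terms sum to `m = a * p * c * q` but have product `m ^ 4`.
    have hlt : (a ^ 3 * p) * (p ^ 3 * c) * (c ^ 3 * q) * (q ^ 3 * a) <
        (a * p * c * q) * (a * p * c * q) * (a * p * c * q) * (a * p * c * q) := by
      have hx' : a ^ 3 * p < a * p * c * q := by linarith
      have hy' : p ^ 3 * c < a * p * c * q := by linarith
      have hz' : c ^ 3 * q < a * p * c * q := by linarith
      have hw' : q ^ 3 * a < a * p * c * q := by linarith
      gcongr
    exact hlt.ne (by ring)
end

section
/- Let F be a field of characteristic 2, regarded as an algebra over 𝔽_2, and let D : F → Ω^1_{F/𝔽_2} be the universal derivation into the module of Kähler differentials. Let x, y, z, w ∈ F with x ≠ 0. Then in the second exterior power of Ω^1_{F/𝔽_2} one has D((z^3 + w^2*x + x*y*z)/x^3) ∧ D(z/x) = (z/x) · (D(y/x) ∧ D(z/x)). (Applied to the function field F of the reduction Y of X modulo 2, this is the computation in Lemma 3 showing that the unique nonzero global 2-form ω on Y, which in the chart where x·G_w ≠ 0 equals d(y/x) ∧ d(z/x) / (G_w/x^3) with G_w = z^3 + w^2*x + x*y*z, can be written as a logarithmic form (dη_1/η_1)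 ∧ (dη_2/η_2) with η_1 = (z^3 + w^2*x + x*y*z)/x^3 and η_2 = z/x.) -/
open ExteriorAlgebra

/-- The square of an element is killed by every derivation in characteristic two. -/
theorem Derivation.map_sq_of_charTwo {R A M : Type*} [CommSemiring R] [CommRing A] [CharP A 2]
    [AddCommGroup M] [Algebra R A] [Module A M] [Module R M] (D : Derivation R A M) (c : A) :
    D (c ^ 2) = 0 := by
  rw [pow_two, D.leibniz, ← add_smul, CharTwo.add_self_eq_zero, zero_smul]

/-- In characteristic two, `D (a ^ 3 + c ^ 2 + b * a) = (a ^ 2 + b) • D a + a • D b`. -/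
theorem Derivation.map_cube_add_sq_add_mul_of_charTwo {R A M : Type*} [CommSemiring R]
    [CommRing A] [CharP A 2] [AddCommGroup M] [Algebra R A] [Module A M] [Module R M]
    (D : Derivation R A M) (a b c : A) :
    D (a ^ 3 + c ^ 2 + b * a) = (a ^ 2 + b) • D a + a • D b := by
  rw [map_add, map_add, pow_succ a 2, D.leibniz, D.leibniz b a, D.map_sq_of_charTwo,
    D.map_sq_of_charTwo, smul_zero, add_zero, add_zero, add_smul, add_assoc]

/-- let `F` be a field of characteristic 2, regarded as an `𝔽_2`-algebra,
with universal derivation `D : F → Ω¹_{F/𝔽_2}`. For `x, y, z, w ∈ F` with `x ≠ 0`, in the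
exterior algebra of the `F`-module `Ω¹_{F/𝔽_2}` one has
`D((z^3 + w^2*x + x*y*z)/x^3) ∧ D(z/x) = (z/x) • (D(y/x) ∧ D(z/x))`. -/
theorem logarithmic_two_form (F : Type*) [Field F] [CharP F 2] [Algebra (ZMod 2) F]
    (x y z w : F) (hx : x ≠ 0) :
    ι F ((KaehlerDifferential.D (ZMod 2) F) ((z ^ 3 + w ^ 2 * x + x * y * z) / x ^ 3)) *
        ι F ((KaehlerDifferential.D (ZMod 2) F) (z / x)) =
      (z / x) •
        (ι F ((KaehlerDifferential.D (ZMod 2) F) (y / x)) *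
          ι F ((KaehlerDifferential.D (ZMod 2) F) (z / x))) := by
  have h : (z ^ 3 + w ^ 2 * x + x * y * z) / x ^ 3 =
      (z / x) ^ 3 + (w / x) ^ 2 + (y / x) * (z / x) := by
    field_simp
  rw [h, Derivation.map_cube_add_sq_add_mul_of_charTwo, map_add, map_smul, map_smul, add_mul,
    smul_mul_assoc, smul_mul_assoc, ι_sq_zero, smul_zero, zero_add]
end

section
/- Let a, b, c, d, e be odd integers. Then there exist y, w ∈ ℤ_2 (the ring of 2-adic integers) such that a*(c*d)^3*y + b*y^3 + c*w + d*(c*d)*w^3 + e*(c*d)*y*w = 0, y ≡ 2*d*e (mod 8), and c + c*d^2*w^2 + c*d*e*y ≡ 7*c (mod 8). (That is, the point P_2 = (cd : y : 1 : w) lies on X_α(ℚ_2), and the value of f_α = c·z^3 + d·w^2·x + e·x·y·z at P_2 is congruent to 7c modulo 8; this is the 2-adic point at which the quaternion algebra of Theorem 4 evaluates nontrivially in Br(ℚ_2).) -/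
open Polynomial in
/-- A cubic `A + B w + D w ^ 3` over `ℤ_[2]` with `A` even and `B` odd has an even root. -/
theorem PadicInt.exists_even_root_cubic (A B D : ℤ_[2]) (hA : (2 : ℤ_[2]) ∣ A)
    (hB : (2 : ℤ_[2]) ∣ B - 1) : ∃ v : ℤ_[2], A + B * (2 * v) + D * (2 * v) ^ 3 = 0 := by
  have norm_lt_one_iff (x : ℤ_[2]) : ‖x‖ < 1 ↔ (2 : ℤ_[2]) ∣ x := by
    simpa using PadicInt.norm_lt_one_iff_dvd (p := 2) x
  have hB_norm : ‖B‖ = 1 := by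
    refine le_antisymm (PadicInt.norm_le_one B) (not_lt.mp fun h => ?_)
    have h2 : (2 : ℤ_[2]) ∣ 1 := by
      simpa using dvd_sub ((norm_lt_one_iff B).mp h) hB
    simpa using (norm_lt_one_iff 1).mpr h2
  let F : ℤ_[2][X] := C A + C B * X + C D * X ^ 3
  have hF (w : ℤ_[2]) : F.aeval w = A + B * w + D * w ^ 3 := by simp [F]
  have hF' : F.derivative.aeval (0 : ℤ_[2]) = B := by simp [F]
  obtain ⟨w, hw, hw_norm, -⟩ := hensels_lemma (p := 2) (F := F) (a := (0 : ℤ_[2])) (by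
    rw [hF, hF', hB_norm]
    simpa using (norm_lt_one_iff A).mpr hA)
  rw [hF', hB_norm, sub_zero] at hw_norm
  obtain ⟨v, rfl⟩ := (norm_lt_one_iff w).mp hw_norm
  exact ⟨v, by rw [← hF, hw]⟩

/-- for odd integers `a, b, c, d, e`, there exist `y, w ∈ ℤ_2` with
`a·(cd)^3·y + b·y^3 + c·w + d·(cd)·w^3 + e·(cd)·y·w = 0`, `y ≡ 2·d·e (mod 8)` and
`c + c·d^2·w^2 + c·d·e·y ≡ 7·c (mod 8)`. -/
theorem exists_two_adic_point_family (a b c d e : ℤ)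
    (ha : Odd a) (hb : Odd b) (hc : Odd c) (hd : Odd d) (he : Odd e) :
    ∃ y w : ℤ_[2],
      (a : ℤ_[2]) * ((c : ℤ_[2]) * d) ^ 3 * y + (b : ℤ_[2]) * y ^ 3 + (c : ℤ_[2]) * w +
        (d : ℤ_[2]) * ((c : ℤ_[2]) * d) * w ^ 3 + (e : ℤ_[2]) * ((c : ℤ_[2]) * d) * y * w = 0 ∧
      (8 : ℤ_[2]) ∣ (y - 2 * d * e) ∧
      (8 : ℤ_[2]) ∣ ((c : ℤ_[2]) + c * d ^ 2 * w ^ 2 + c * d * e * y - 7 * c) := by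
  have hde : Odd (d * e) := hd.mul he
  have hA : Odd (a * (c * d) ^ 3 * (d * e) + 4 * b * (d * e) ^ 3) :=
    ((ha.mul (hc.mul hd).pow).mul hde).add_even (by simp [show Even (4 : ℤ) by decide])
  have hB : Odd (c + 2 * c * (d * e) ^ 2) :=
    hc.add_even (by simp)
  obtain ⟨m, hm⟩ := hde
  obtain ⟨k, hk⟩ := hA
  obtain ⟨l, hl⟩ := hB
  obtain ⟨n, hn⟩ := hd
  replace hm := congrArg (Int.cast : ℤ → ℤ_[2]) hm
  replace hk := congrArg (Int.cast : ℤ → ℤ_[2]) hk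
  replace hl := congrArg (Int.cast : ℤ → ℤ_[2]) hl
  replace hn := congrArg (Int.cast : ℤ → ℤ_[2]) hn
  push_cast at hm hk hl hn
  obtain ⟨v, hv⟩ := PadicInt.exists_even_root_cubic (2 * (2 * k + 1)) (2 * l + 1) (c * d ^ 2)
    ⟨_, rfl⟩ ⟨l, by ring⟩
  have hv_odd : v = 2 * (-k - l * v - 2 * c * d ^ 2 * v ^ 3) - 1 := by
    refine mul_left_cancel₀ (two_ne_zero (α := ℤ_[2])) ?_
    linear_combination hv
  obtain ⟨t, ht⟩ : ∃ t : ℤ_[2], v = 2 * t - 1 := ⟨_, hv_odd⟩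
  refine ⟨2 * d * e, 2 * v, ?_, by simp, ?_⟩
  · rw [← hk, ← hl] at hv
    linear_combination hv
  · obtain ⟨s, hs⟩ : ∃ s : ℤ_[2], (d : ℤ_[2]) * v = 2 * s + 1 :=
      ⟨2 * n * t - n + t - 1, by rw [hn, ht]; ring⟩
    refine ⟨c * (2 * (s ^ 2 + s) + (m ^ 2 + m)), ?_⟩
    linear_combination 4 * (c : ℤ_[2]) * (d * v + 2 * s + 1) * hs +
      2 * (c : ℤ_[2]) * (d * e + 2 * m + 1) * hm
end
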